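/- Let a, b, c be real constants with c > 0, b > 0 and b² + 27ac > 0, and set s₊ = (b + √(b² + 24ac))/(4c). Then there exist δ* > 0 and C > 0 such that for every Q ∈ Q₀ with dist(Q, N) < δ*: (1/C)·F̂_b(Q) ≤ |J(Q)|² ≤ C·F̂_b(Q). -/

import Mathlib

noncomputable section

open Matrix

/-- The space of 3×3 real matrices. -/
abbrev Mat3 := Matrix (Fin 3) (Fin 3) ℝ

/-- Frobenius inner product `A : B = ∑ᵢⱼ Aᵢⱼ Bᵢⱼ`. -/
def frob (A B : Mat3) : ℝ := ∑ i, ∑ j, A i j * B i j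

/-- Frobenius norm. -/
def fnorm (A : Mat3) : ℝ := Real.sqrt (frob A A)

/-- The uniaxial matrix `s (d ⊗ d - (1/3) I)`. -/
def uniax (s : ℝ) (d : Fin 3 → ℝ) : Mat3 :=
  s • (vecMulVec d d - (1 / 3 : ℝ) • (1 : Mat3))

/-- The distance (in Frobenius norm) from `Q` to the limit manifold
`N = { s(d⊗d - (1/3)I) : |d| = 1 }`. -/
def distN (s : ℝ) (Q : Mat3) : ℝ :=
  sInf ((fun d : Fin 3 → ℝ => fnorm (Q - uniax s d)) '' {d | ∑ i, d i ^ 2 = 1})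

/-- Landau–de Gennes bulk energy density
`F_b(Q) = -(a/2)|Q|² - (b/3) tr(Q³) + (c/4)|Q|⁴`. -/
def Fb (a b c : ℝ) (Q : Mat3) : ℝ :=
  -(a / 2) * frob Q Q - (b / 3) * (Q * Q * Q).trace + (c / 4) * (frob Q Q) ^ 2

/-- `f_b(s) = -(a/3)s² - (2b/27)s³ + (c/9)s⁴`, the value of `F_b` at the
uniaxial matrix `s(d⊗d - (1/3)I)` for a unit vector `d`. -/
def fbulk (a b c s : ℝ) : ℝ :=
  -(a / 3) * s ^ 2 - (2 * b / 27) * s ^ 3 + (c / 9) * s ^ 4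

/-- The normalized bulk energy `F̂_b(Q) = F_b(Q) - f_b(s₊)`. -/
def hatFb (a b c s : ℝ) (Q : Mat3) : ℝ := Fb a b c Q - fbulk a b c s

/-- `J(Q) = -aQ - b(Q² - (1/3)|Q|² I) + c|Q|² Q`, the derivative of the bulk
energy `F_b`. -/
def Jmap (a b c : ℝ) (Q : Mat3) : Mat3 :=
  (-a) • Q - b • (Q * Q - ((1 / 3 : ℝ) * frob Q Q) • (1 : Mat3)) +
    (c * frob Q Q) • Q

lemma frob_self_nonneg (A : Mat3) : 0 ≤ frob A A :=
  Finset.sum_nonneg fun i _ => Finset.sum_nonneg fun j _ => mul_self_nonneg (A i j)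

/-- Cauchy–Schwarz for the Frobenius inner product. -/
lemma frob_sq_le (A B : Mat3) : frob A B ^ 2 ≤ frob A A * frob B B := by
  have h := Finset.sum_mul_sq_le_sq_mul_sq (Finset.univ : Finset (Fin 3 × Fin 3))
    (fun p => A p.1 p.2) (fun p => B p.1 p.2)
  simpa only [frob, Fintype.sum_prod_type, pow_two (A _ _), pow_two (B _ _)] using h

section FrobeniusNorm

attribute [local instance] Matrix.frobeniusNormedAddCommGroup

lemma fnorm_eq_norm (A : Mat3) : fnorm A = ‖A‖ := by
  simp [fnorm, frob, Matrix.frobenius_norm_def, Real.sqrt_eq_rpow, pow_two]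

lemma abs_fnorm_sub_fnorm_le (A B : Mat3) : |fnorm A - fnorm B| ≤ fnorm (A - B) := by
  simpa only [fnorm_eq_norm] using abs_norm_sub_norm_le A B

end FrobeniusNorm

lemma frob_uniax (s : ℝ) {d : Fin 3 → ℝ} (hd : ∑ i, d i ^ 2 = 1) :
    frob (uniax s d) (uniax s d) = 2 / 3 * s ^ 2 := by
  have h0 : d 0 ^ 2 = 1 - d 1 ^ 2 - d 2 ^ 2 := by
    rw [Fin.sum_univ_three] at hd
    linarith
  simp [frob, uniax, vecMulVec_apply, Fin.sum_univ_three, Matrix.one_apply]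
  linear_combination s ^ 2 * (d 0 ^ 2 + 1 + d 1 ^ 2 + d 2 ^ 2 - 2 / 3) * h0

/-- A symmetric traceless matrix is determined by five of its entries. -/
lemma exists_entries {Q : Mat3} (hQ : Q.IsSymm) (ht : Q.trace = 0) :
    ∃ x y p q r : ℝ, Q = !![x, p, q; p, y, r; q, r, -x - y] := by
  refine ⟨Q 0 0, Q 1 1, Q 0 1, Q 0 2, Q 1 2, ?_⟩
  rw [Matrix.trace_fin_three] at ht
  ext i j
  fin_cases i <;> fin_cases j <;> simp [hQ.apply 0 1, hQ.apply 0 2, hQ.apply 1 2]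
  linarith

/-- `tr(Q³)² ≤ |Q|⁶ / 6` on symmetric traceless matrices. -/
lemma trace_cube_sq_le {Q : Mat3} (hQ : Q.IsSymm) (ht : Q.trace = 0) :
    (Q * Q * Q).trace ^ 2 ≤ frob Q Q ^ 3 / 6 := by
  have h := frob_sq_le Q (Q * Q - ((1 / 3 : ℝ) * frob Q Q) • (1 : Mat3))
  obtain ⟨x, y, p, q, r, rfl⟩ := exists_entries hQ ht
  simp [frob, Matrix.trace_fin_three, Fin.sum_univ_three, Matrix.one_apply]
    at h ⊢
  convert h using 1 <;> ring

lemma frob_Jmap (a b c : ℝ) {Q : Mat3} (hQ : Q.IsSymm) (ht : Q.trace = 0) :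
    frob (Jmap a b c Q) (Jmap a b c Q) = (c * frob Q Q - a) ^ 2 * frob Q Q
      - 2 * b * (c * frob Q Q - a) * (Q * Q * Q).trace + b ^ 2 * frob Q Q ^ 2 / 6 := by
  obtain ⟨x, y, p, q, r, rfl⟩ := exists_entries hQ ht
  simp [Jmap, frob, Matrix.trace_fin_three, Fin.sum_univ_three,
    Matrix.one_apply]
  ring

/-- The order parameter `√(3/2) |Q|`, equal to `s` at `uniax s d` for `s ≥ 0`, `|d| = 1`. -/
def orderParam (Q : Mat3) : ℝ := √(3 / 2) * fnorm Q

lemma orderParam_sq (Q : Mat3) : frob Q Q = 2 / 3 * orderParam Q ^ 2 := by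
  rw [orderParam, mul_pow, fnorm, Real.sq_sqrt (by norm_num), Real.sq_sqrt (frob_self_nonneg Q)]
  ring

lemma orderParam_nonneg (Q : Mat3) : 0 ≤ orderParam Q :=
  mul_nonneg (Real.sqrt_nonneg _) (Real.sqrt_nonneg _)

lemma orderParam_uniax {s : ℝ} (hs : 0 ≤ s) {d : Fin 3 → ℝ} (hd : ∑ i, d i ^ 2 = 1) :
    orderParam (uniax s d) = s := by
  have h := orderParam_sq (uniax s d)
  rw [frob_uniax s hd] at h
  exact (pow_left_inj₀ (orderParam_nonneg _) hs two_ne_zero).1 (by linarith)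

lemma abs_orderParam_sub_lt {s δ : ℝ} (hs : 0 ≤ s) {Q : Mat3} (hQ : distN s Q < δ) :
    |orderParam Q - s| < 2 * δ := by
  obtain ⟨_, ⟨d, hd, rfl⟩, hlt⟩ := exists_lt_of_csInf_lt
    (Set.Nonempty.image _ ⟨Pi.single 0 1, by simp [Fin.sum_univ_three]⟩) hQ
  have hk : √(3 / 2 : ℝ) ≤ 2 := Real.sqrt_le_iff.2 (by norm_num)
  calc |orderParam Q - s| = √(3 / 2) * |fnorm Q - fnorm (uniax s d)| := by
        conv_lhs => rw [← orderParam_uniax hs hd, orderParam, orderParam, ← mul_sub, abs_mul,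
          abs_of_nonneg (Real.sqrt_nonneg _)]
    _ ≤ 2 * fnorm (Q - uniax s d) :=
        mul_le_mul hk (abs_fnorm_sub_fnorm_le _ _) (abs_nonneg _) zero_le_two
    _ < 2 * δ := by
        have : fnorm (Q - uniax s d) < δ := hlt
        linarith

lemma trace_cube_le {Q : Mat3} (hQ : Q.IsSymm) (ht : Q.trace = 0) :
    (Q * Q * Q).trace ≤ 2 / 9 * orderParam Q ^ 3 := by
  have h := trace_cube_sq_le hQ ht
  rw [orderParam_sq] at h
  have h0 := orderParam_nonneg Q
  refine le_of_abs_le (abs_le_of_sq_le_sq (h.trans_eq ?_) (by positivity))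
  ring

/-- Two continuous functions positive at a point are comparable near it. -/
lemma exists_eventually_comparable {f g : ℝ → ℝ} {s : ℝ} (hf : Continuous f) (hg : Continuous g)
    (hfs : 0 < f s) (hgs : 0 < g s) :
    ∃ C₀ : ℝ, ∀ C, C₀ ≤ C → ∀ᶠ r in nhds s, f r ≤ C * g r ∧ g r ≤ C * f r := by
  refine ⟨f s / g s + g s / f s + 1, fun C hC => ?_⟩
  have h1 : f s < C * g s := by
    rw [← div_lt_iff₀ hgs]
    have := div_pos hgs hfs
    linarith
  have h2 : g s < C * f s := by
    rw [← div_lt_iff₀ hfs]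
    have := div_pos hfs hgs
    linarith
  filter_upwards [hf.continuousAt.eventually_lt (hg.const_mul C).continuousAt h1,
    hg.continuousAt.eventually_lt (hf.const_mul C).continuousAt h2] with r h₁ h₂
  exact ⟨h₁.le, h₂.le⟩

/-- for `c > 0`, `b > 0`, `b² + 27ac > 0` and
`s₊ = (b + √(b²+24ac))/(4c)`, there exist `δ* > 0` and `C > 0` such that
`(1/C)·F̂_b(Q) ≤ |J(Q)|² ≤ C·F̂_b(Q)` whenever `Q ∈ Q₀` and `dist(Q,N) < δ*`. -/
theorem stmt9 (a b c : ℝ) (hc : 0 < c) (hb : 0 < b) (h : 0 < b ^ 2 + 27 * a * c)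
    (s : ℝ) (hs : s = (b + Real.sqrt (b ^ 2 + 24 * a * c)) / (4 * c)) :
    ∃ δ : ℝ, 0 < δ ∧ ∃ C : ℝ, 0 < C ∧
      ∀ Q : Mat3, Q.IsSymm → Q.trace = 0 → distN s Q < δ →
        (1 / C) * hatFb a b c s Q ≤ frob (Jmap a b c Q) (Jmap a b c Q) ∧
          frob (Jmap a b c Q) (Jmap a b c Q) ≤ C * hatFb a b c s Q := by
  have hD : 0 < b ^ 2 + 24 * a * c := by
    rcases le_or_gt 0 a with ha | ha
    · positivity
    · nlinarith [mul_pos (neg_pos.2 ha) hc]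
  have hroot : 0 < 4 * c * s - b := by
    have : 4 * c * s = b + √(b ^ 2 + 24 * a * c) := by
      rw [hs]
      field_simp
    linarith [Real.sqrt_pos.2 hD]
  have hs0 : 0 < s := by
    rw [hs]
    positivity
  have ha : 3 * a = 2 * c * s ^ 2 - b * s := by
    have h1 : (4 * c * s - b) ^ 2 = b ^ 2 + 24 * a * c := by
      rw [hs, ← Real.sq_sqrt hD.le]
      congr 1
      rw [Real.sq_sqrt hD.le]
      field_simp
      ring
    refine mul_left_cancel₀ (mul_pos (by norm_num : (0 : ℝ) < 8) hc).ne' ?_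
    linear_combination -h1
  set g : ℝ → ℝ := fun r =>
    c / 9 * (r ^ 2 + 2 * s * r + 3 * s ^ 2) - 2 * b / 27 * (r + 2 * s) - a / 3 with hg
  set G : ℝ → ℝ := fun r => 2 * r ^ 2 / 27 * (2 * c * r + 2 * c * s - b) ^ 2 with hG
  set H : ℝ → ℝ := fun r => 2 * b * (c * (2 / 3 * r ^ 2) - a) with hH
  have hgs : 0 < g s := by
    have : g s = s * (4 * c * s - b) / 9 := by
      simp only [hg]
      linear_combination -ha / 9
    rw [this]
    positivity
  have hGs : 0 < G s := by
    have : G s = 2 * s ^ 2 / 27 * (4 * c * s - b) ^ 2 := by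
      simp only [hG]
      ring
    rw [this]
    positivity
  have hHs : 0 < H s := by
    have : H s = 2 * b ^ 2 * s / 3 := by
      simp only [hH]
      linear_combination -2 * b / 3 * ha
    rw [this]
    positivity
  obtain ⟨C₁, hC₁⟩ := exists_eventually_comparable (f := g) (g := G) (by fun_prop) (by fun_prop)
    hgs hGs
  obtain ⟨C₂, hC₂⟩ := exists_eventually_comparable (f := fun _ => b / 3) (g := H) (s := s)
    (by fun_prop) (by fun_prop) (by positivity) hHs
  set C := max 1 (max C₁ C₂) with hC
  have hC0 : 0 < C := lt_of_lt_of_le one_pos (le_max_left _ _)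
  obtain ⟨ε, hε, hball⟩ := Metric.eventually_nhds_iff.1
    ((hC₁ C ((le_max_left _ _).trans (le_max_right _ _))).and
      (hC₂ C ((le_max_right _ _).trans (le_max_right _ _))))
  refine ⟨ε / 2, by positivity, C, hC0, fun Q hQ ht hdist => ?_⟩
  have hr := abs_orderParam_sub_lt hs0.le hdist
  have hw := sub_nonneg.2 (trace_cube_le hQ ht)
  obtain ⟨⟨h1, h2⟩, h3, h4⟩ := @hball (orderParam Q) (by rw [Real.dist_eq]; linarith)
  have hF : hatFb a b c s Q = (orderParam Q - s) ^ 2 * g (orderParam Q)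
      + b / 3 * (2 / 9 * orderParam Q ^ 3 - (Q * Q * Q).trace) := by
    simp only [hatFb, Fb, fbulk, hg, orderParam_sq]
    linear_combination 2 * s * (s - orderParam Q) / 9 * ha
  have hJ : frob (Jmap a b c Q) (Jmap a b c Q) = (orderParam Q - s) ^ 2 * G (orderParam Q)
      + H (orderParam Q) * (2 / 9 * orderParam Q ^ 3 - (Q * Q * Q).trace) := by
    rw [frob_Jmap a b c hQ ht, orderParam_sq]
    simp only [hG, hH]
    generalize orderParam Q = r
    have hfac : c * (2 / 3 * r ^ 2) - a - b * r / 3 = (r - s) * (2 * c * r + 2 * c * s - b) / 3 := by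
      linear_combination -ha / 3
    linear_combination 2 / 3 * r ^ 2 * (c * (2 / 3 * r ^ 2) - a - b * r / 3
      + (r - s) * (2 * c * r + 2 * c * s - b) / 3) * hfac
  have hsq := sq_nonneg (orderParam Q - s)
  rw [hF, hJ]
  constructor
  · rw [one_div, inv_mul_le_iff₀ hC0]
    linarith [mul_le_mul_of_nonneg_left h1 hsq, mul_le_mul_of_nonneg_right h3 hw]
  · linarith [mul_le_mul_of_nonneg_left h2 hsq, mul_le_mul_of_nonneg_right h4 hw]
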